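/- Let p ∈ (p_c, p_*), γ ∈ ℝ, and suppose: ‖f(·,t)‖_{L^1(ℝ^N)} ≤ C₀ (1+t)^{−γ} for all t ≥ 0; there are R₀, C₁ > 0 with |f(x,t)| ≤ C₁ |x|^{−N} (1+t)^{−γ} for all |x| ≥ R₀ and t ≥ 0; and ‖f(·,t)‖_{L^q(ℝ^N)} ≤ C₀ (1+t)^{−γ} for all t ≥ 0, for some q > q_c(p) := N/(2β + N/p). Then there is a constant C such that the mild solution u satisfies, for all t ≥ 2: ‖u(·,t)‖_{L^p(ℝ^N)} ≤ C t^{−γ} if γ ≤ 1−α+(αN/(2β))(1−1/p), and ‖u(·,t)‖_{L^p(ℝ^N)} ≤ C t^{−1+α−(αN/(2β))(1−1/p)} if γ ≥ 1−α+(αN/(2β))(1−1/p). -/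

import Mathlib

open MeasureTheory Real Set Filter
open scoped ENNReal Pointwise

theorem aux_young {N : ℕ} (h f : EuclideanSpace ℝ (Fin N) → ℝ≥0∞) (hh : Measurable h)
    (hf : Measurable f) (p q r : ℝ) (hp : 0 < p) (hq : 0 < q) (hr : 0 < r) (hqp : q ≤ p)
    (hrp : r ≤ p) (hpqr : 1 / p + 1 = 1 / r + 1 / q) :
    ∫⁻ x, (∫⁻ y, h (x - y) * f y) ^ p ≤
      (∫⁻ x, h x ^ r) ^ (p / r) * (∫⁻ x, f x ^ q) ^ (p / q) := by
  have h1 : 0 ≤ 1 / p := by positivity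
  have h2 : 0 ≤ 1 / r - 1 / p := sub_nonneg.2 (one_div_le_one_div_of_le hr hrp)
  have h3 : 0 ≤ 1 / q - 1 / p := sub_nonneg.2 (one_div_le_one_div_of_le hq hqp)
  set H := ∫⁻ x, h x ^ r with hH
  set F := ∫⁻ x, f x ^ q with hF
  have hpt : ∀ x, ∫⁻ y, h (x - y) * f y ≤
      (∫⁻ y, h (x - y) ^ r * f y ^ q) ^ (1 / p) * (H ^ (1 / r - 1 / p) * F ^ (1 / q - 1 / p)) := by
    intro x
    have hHx : ∫⁻ y, h (x - y) ^ r = H := lintegral_sub_left_eq_self (fun z => h z ^ r) x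
    have key := ENNReal.lintegral_prod_norm_pow_le (μ := (volume : Measure (EuclideanSpace ℝ (Fin N))))
      (Finset.univ : Finset (Fin 3))
      (f := ![fun y => h (x - y) ^ r * f y ^ q, fun y => h (x - y) ^ r, fun y => f y ^ q])
      (by
        intro i _
        fin_cases i
        · exact (by fun_prop : Measurable (fun y => h (x - y) ^ r * f y ^ q)).aemeasurable
        · exact (by fun_prop : Measurable (fun y => h (x - y) ^ r)).aemeasurable
        · exact (by fun_prop : Measurable (fun y => f y ^ q)).aemeasurable)
      (p := ![1 / p, 1 / r - 1 / p, 1 / q - 1 / p])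
      (by simp [Fin.sum_univ_three] at *; linarith)
      (by
        intro i _
        fin_cases i
        · exact h1
        · exact h2
        · exact h3)
    simp only [Fin.prod_univ_three, Matrix.cons_val_zero, Matrix.cons_val_one, Matrix.cons_val] at key
    rw [hHx, ← hF, mul_assoc] at key
    refine le_trans (le_of_eq (lintegral_congr fun y => ?_)) key
    rw [ENNReal.mul_rpow_of_nonneg _ _ h1, ← ENNReal.rpow_mul, ← ENNReal.rpow_mul,
      ← ENNReal.rpow_mul, ← ENNReal.rpow_mul]
    have e1 : h (x - y) = h (x - y) ^ (r * (1 / p)) * h (x - y) ^ (r * (1 / r - 1 / p)) := by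
      rw [← ENNReal.rpow_add_of_nonneg _ _ (by positivity) (by positivity)]
      have : r * (1 / p) + r * (1 / r - 1 / p) = 1 := by field_simp; ring
      rw [this, ENNReal.rpow_one]
    have e2 : f y = f y ^ (q * (1 / p)) * f y ^ (q * (1 / q - 1 / p)) := by
      rw [← ENNReal.rpow_add_of_nonneg _ _ (by positivity) (by positivity)]
      have : q * (1 / p) + q * (1 / q - 1 / p) = 1 := by field_simp; ring
      rw [this, ENNReal.rpow_one]
    conv_lhs => rw [e1, e2]
    ring
  calc ∫⁻ x, (∫⁻ y, h (x - y) * f y) ^ p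
      ≤ ∫⁻ x, (∫⁻ y, h (x - y) ^ r * f y ^ q) *
          (H ^ (1 / r - 1 / p) * F ^ (1 / q - 1 / p)) ^ p := by
        refine lintegral_mono fun x => ?_
        refine (ENNReal.rpow_le_rpow (hpt x) hp.le).trans (le_of_eq ?_)
        rw [ENNReal.mul_rpow_of_nonneg _ _ hp.le, ← ENNReal.rpow_mul]
        rw [one_div_mul_cancel hp.ne', ENNReal.rpow_one]
    _ = (H * F) * (H ^ (1 / r - 1 / p) * F ^ (1 / q - 1 / p)) ^ p := by
        rw [lintegral_mul_const _ (by
          apply Measurable.lintegral_prod_right'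
            (f := fun z : EuclideanSpace ℝ (Fin N) × EuclideanSpace ℝ (Fin N) =>
              h (z.1 - z.2) ^ r * f z.2 ^ q)
          fun_prop)]
        congr 1
        rw [lintegral_lintegral_swap (by
          apply Measurable.aemeasurable
          simp only [Function.uncurry_def]
          fun_prop)]
        have : ∀ y, ∫⁻ x, h (x - y) ^ r * f y ^ q = H * f y ^ q := by
          intro y
          rw [lintegral_mul_const _ (by fun_prop)]
          congr 1
          exact lintegral_sub_right_eq_self (fun z => h z ^ r) y
        simp_rw [this]
        rw [lintegral_const_mul _ (by fun_prop)]
    _ = H ^ (p / r) * F ^ (p / q) := by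
        rw [ENNReal.mul_rpow_of_nonneg _ _ hp.le, ← ENNReal.rpow_mul, ← ENNReal.rpow_mul]
        have e1 : H ^ (p / r) = H * H ^ ((1 / r - 1 / p) * p) := by
          nth_rw 2 [← ENNReal.rpow_one H]
          rw [← ENNReal.rpow_add_of_nonneg _ _ (by positivity) (by positivity)]
          congr 1
          field_simp; ring
        have e2 : F ^ (p / q) = F * F ^ ((1 / q - 1 / p) * p) := by
          nth_rw 2 [← ENNReal.rpow_one F]
          rw [← ENNReal.rpow_add_of_nonneg _ _ (by positivity) (by positivity)]
          congr 1
          field_simp; ring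
        rw [e1, e2]; ring

theorem aux_minkowski {E : Type*} [MeasurableSpace E] (ν : Measure E) [SFinite ν]
    (μ : Measure ℝ) [SFinite μ] (g : E → ℝ → ℝ≥0∞) (hg : Measurable (Function.uncurry g))
    (M : ℝ → ℝ≥0∞) (hM : Measurable M) (p : ℝ) (hp : 1 ≤ p)
    (hM0 : ∀ᵐ s ∂μ, M s ≠ 0) (hMt : ∀ᵐ s ∂μ, M s ≠ ∞)
    (hb : ∀ᵐ s ∂μ, ∫⁻ x, g x s ^ p ∂ν ≤ M s ^ p) :
    ∫⁻ x, (∫⁻ s, g x s ∂μ) ^ p ∂ν ≤ (∫⁻ s, M s ∂μ) ^ p := by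
  have hp0 : 0 < p := by linarith
  have h1 : 0 ≤ 1 / p := by positivity
  have h2 : 0 ≤ 1 - 1 / p := by
    rw [sub_nonneg, div_le_one hp0]; exact hp
  have hgx : ∀ x, Measurable (g x) := fun x => hg.of_uncurry_left
  have hpt : ∀ x, ∫⁻ s, g x s ∂μ ≤
      (∫⁻ s, g x s ^ p * M s ^ (1 - p) ∂μ) ^ (1 / p) * (∫⁻ s, M s ∂μ) ^ (1 - 1 / p) := by
    intro x
    refine le_trans (le_of_eq (lintegral_congr_ae ?_))
      (ENNReal.lintegral_mul_norm_pow_le (f := fun s => g x s ^ p * M s ^ (1 - p)) (g := M)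
        (((hgx x).pow_const _).mul (hM.pow_const _)).aemeasurable hM.aemeasurable h1 h2 (by ring))
    filter_upwards [hM0, hMt] with s hs0 hst
    rw [ENNReal.mul_rpow_of_nonneg _ _ h1, ← ENNReal.rpow_mul, ← ENNReal.rpow_mul, mul_assoc,
      ← ENNReal.rpow_add _ _ hs0 hst]
    have e1 : p * (1 / p) = 1 := by field_simp
    have e2 : (1 - p) * (1 / p) + (1 - 1 / p) = 0 := by field_simp; ring
    rw [e1, e2]; simp
  calc ∫⁻ x, (∫⁻ s, g x s ∂μ) ^ p ∂ν
      ≤ ∫⁻ x, (∫⁻ s, g x s ^ p * M s ^ (1 - p) ∂μ) * (∫⁻ s, M s ∂μ) ^ (p - 1) ∂ν := by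
        refine lintegral_mono fun x => ?_
        refine (ENNReal.rpow_le_rpow (hpt x) hp0.le).trans (le_of_eq ?_)
        rw [ENNReal.mul_rpow_of_nonneg _ _ hp0.le, ← ENNReal.rpow_mul, ← ENNReal.rpow_mul]
        have e1 : 1 / p * p = 1 := by field_simp
        have e2 : (1 - 1 / p) * p = p - 1 := by field_simp
        rw [e1, e2, ENNReal.rpow_one]
    _ = (∫⁻ s, ∫⁻ x, g x s ^ p * M s ^ (1 - p) ∂ν ∂μ) * (∫⁻ s, M s ∂μ) ^ (p - 1) := by
        have hm : Measurable (Function.uncurry fun x s => g x s ^ p * M s ^ (1 - p)) :=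
          (hg.pow_const _).mul ((hM.comp measurable_snd).pow_const _)
        rw [lintegral_mul_const _ (Measurable.lintegral_prod_right hm),
          lintegral_lintegral_swap hm.aemeasurable]
    _ ≤ (∫⁻ s, M s ∂μ) * (∫⁻ s, M s ∂μ) ^ (p - 1) := by
        refine mul_le_mul_left ?_ _
        refine lintegral_mono_ae ?_
        filter_upwards [hM0, hMt, hb] with s hs0 hst hbs
        have hgs : Measurable fun x => g x s := hg.of_uncurry_right
        rw [lintegral_mul_const _ (hgs.pow_const _)]
        calc _ ≤ M s ^ p * M s ^ (1 - p) := by gcongr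
          _ = M s := by rw [← ENNReal.rpow_add _ _ hs0 hst]; simp
    _ = (∫⁻ s, M s ∂μ) ^ p := by
        nth_rw 1 [← ENNReal.rpow_one (∫⁻ s, M s ∂μ)]
        rw [← ENNReal.rpow_add_of_nonneg _ _ (by positivity) (by linarith)]
        congr 1; ring

noncomputable def auxK (a b τ : ℝ) : ℝ := if τ ≤ 1 then τ ^ a else τ ^ b

theorem auxK_meas (a b : ℝ) : Measurable (auxK a b) := by
  unfold auxK
  exact Measurable.ite measurableSet_Iic (by fun_prop) (by fun_prop)

theorem auxK_pos (a b τ : ℝ) (h : 0 < τ) : 0 < auxK a b τ := by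
  unfold auxK; split_ifs <;> positivity

theorem auxK_integrable (a b : ℝ) (ha : -1 < a) (hb : b < -1) :
    IntegrableOn (auxK a b) (Ioi 0) := by
  rw [← Ioc_union_Ioi_eq_Ioi (zero_le_one (α := ℝ))]
  refine IntegrableOn.union ?_ ?_
  · rw [integrableOn_Ioc_iff_integrableOn_Ioo]
    refine ((intervalIntegral.integrableOn_Ioo_rpow_iff one_pos).2 ha).congr_fun ?_ measurableSet_Ioo
    intro x hx
    simp [auxK, hx.2.le]
  · refine (integrableOn_Ioi_rpow_of_lt hb one_pos).congr_fun ?_ measurableSet_Ioi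
    intro x hx
    simp [auxK, not_le.2 (mem_Ioi.1 hx)]

theorem auxG_fin (N : ℕ) (β : ℝ) (hβ : 0 < β) (hN : 4 * β < (N : ℝ))
    (G : EuclideanSpace ℝ (Fin N) → ℝ)
    (hGnonneg : ∀ ξ, 0 ≤ G ξ) (c₂ : ℝ) (hc₂ : 0 < c₂)
    (hGin : ∀ ξ : EuclideanSpace ℝ (Fin N), 0 < ‖ξ‖ → ‖ξ‖ ≤ 1 →
      G ξ ≤ c₂ * ‖ξ‖ ^ (4 * β - (N : ℝ)))
    (hGout : ∀ ξ : EuclideanSpace ℝ (Fin N), 1 ≤ ‖ξ‖ → G ξ ≤ c₂ * ‖ξ‖ ^ (-((N : ℝ) + 2 * β)))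
    (r : ℝ) (hr : 1 ≤ r) (hr' : r * (N - 4 * β) < N) :
    ∫⁻ x, ‖G x‖ₑ ^ r ≠ ∞ := by
  have hN0 : 0 < (N : ℝ) := by linarith
  have hNn : 0 < N := by exact_mod_cast hN0
  have : Nonempty (Fin N) := ⟨⟨0, hNn⟩⟩
  have : Nontrivial (EuclideanSpace ℝ (Fin N)) := inferInstance
  have hint : Integrable (fun x : EuclideanSpace ℝ (Fin N) =>
      auxK ((4 * β - N) * r) (-((N : ℝ) + 2 * β) * r) ‖x‖) volume := by
    rw [integrable_fun_norm_addHaar (volume : Measure (EuclideanSpace ℝ (Fin N)))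
      (f := auxK ((4 * β - N) * r) (-((N : ℝ) + 2 * β) * r))]
    refine (auxK_integrable ((N : ℝ) - 1 + (4 * β - N) * r)
      ((N : ℝ) - 1 + (-((N : ℝ) + 2 * β) * r)) (by linarith) (by nlinarith)).congr_fun ?_
      measurableSet_Ioi
    intro y hy
    have hy : 0 < y := hy
    have : y ^ (N - 1) = y ^ ((N : ℝ) - 1) := by
      rw [← Real.rpow_natCast, Nat.cast_sub hNn]; simp
    simp only [finrank_euclideanSpace, Fintype.card_fin, smul_eq_mul, this]
    unfold auxK
    split_ifs <;> rw [Real.rpow_add hy]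
  have hint2 := (hint.const_mul (c₂ ^ r)).lintegral_lt_top
  refine ne_of_lt (lt_of_le_of_lt (lintegral_mono_ae ?_) hint2)
  have h0 : ∀ᵐ x : EuclideanSpace ℝ (Fin N), x ≠ 0 := by
    simp [ae_iff]
  filter_upwards [h0] with x hx
  have hx : 0 < ‖x‖ := norm_pos_iff.2 hx
  rw [Real.enorm_of_nonneg (hGnonneg x), ENNReal.ofReal_rpow_of_nonneg (hGnonneg x) (by linarith)]
  apply ENNReal.ofReal_le_ofReal
  unfold auxK
  split_ifs with h
  · rw [Real.rpow_mul hx.le, ← Real.mul_rpow hc₂.le (by positivity)]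
    exact Real.rpow_le_rpow (hGnonneg x) (hGin x hx h) (by linarith)
  · rw [Real.rpow_mul hx.le, ← Real.mul_rpow hc₂.le (by positivity)]
    exact Real.rpow_le_rpow (hGnonneg x) (hGout x (not_le.1 h).le) (by linarith)

theorem auxY (N : ℕ) (α σ : ℝ) (G : EuclideanSpace ℝ (Fin N) → ℝ) (hG : Measurable G) (r : ℝ)
    (hr : 0 < r) (hfin : ∫⁻ x, ‖G x‖ₑ ^ r ≠ ∞) :
    ∃ A : ℝ, 0 < A ∧ ∀ τ : ℝ, 0 < τ →
      ∫⁻ x, ‖τ ^ (α - 1 - σ * N) * G (τ ^ (-σ) • x)‖ₑ ^ r ≤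
        ENNReal.ofReal (A * τ ^ (α - 1 - σ * N * (1 - 1 / r))) ^ r := by
  set I := ∫⁻ x, ‖G x‖ₑ ^ r with hI
  refine ⟨(I.toReal + 1) ^ (1 / r), by positivity, fun τ hτ => ?_⟩
  have hsc : ∫⁻ x, ‖G (τ ^ (-σ) • x)‖ₑ ^ r = ENNReal.ofReal (τ ^ (σ * N)) * I := by
    have hne : τ ^ (-σ) ≠ 0 := (Real.rpow_pos_of_pos hτ _).ne'
    have := Measure.map_addHaar_smul (volume : Measure (EuclideanSpace ℝ (Fin N))) hne
    rw [← lintegral_map (f := fun z => ‖G z‖ₑ ^ r) (by fun_prop) (by fun_prop), this,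
      lintegral_smul_measure, smul_eq_mul]
    congr 2
    rw [abs_of_pos (by positivity), finrank_euclideanSpace, Fintype.card_fin, ← Real.rpow_natCast,
      ← Real.rpow_mul hτ.le, ← Real.rpow_neg hτ.le]
    congr 1; ring
  have hp0 : 0 < τ ^ (α - 1 - σ * N) := by positivity
  calc _ = ∫⁻ x, ENNReal.ofReal (τ ^ (α - 1 - σ * N)) ^ r * ‖G (τ ^ (-σ) • x)‖ₑ ^ r := by
        refine lintegral_congr fun x => ?_
        rw [enorm_mul, ENNReal.mul_rpow_of_nonneg _ _ hr.le, Real.enorm_of_nonneg hp0.le]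
    _ = ENNReal.ofReal (τ ^ (α - 1 - σ * N)) ^ r * (ENNReal.ofReal (τ ^ (σ * N)) * I) := by
        rw [lintegral_const_mul _ (by fun_prop), hsc]
    _ ≤ ENNReal.ofReal (τ ^ (α - 1 - σ * N)) ^ r *
          (ENNReal.ofReal (τ ^ (σ * N)) * ENNReal.ofReal (I.toReal + 1)) := by
        gcongr
        rw [ENNReal.le_ofReal_iff_toReal_le hfin (by positivity)]
        linarith
    _ = _ := by
        rw [ENNReal.ofReal_rpow_of_pos hp0, ENNReal.ofReal_rpow_of_pos (by positivity),
          ← ENNReal.ofReal_mul (by positivity), ← ENNReal.ofReal_mul (by positivity),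
          Real.mul_rpow (by positivity) (by positivity), ← Real.rpow_mul hτ.le,
          ← Real.rpow_mul (by positivity : 0 ≤ I.toReal + 1), ← Real.rpow_mul hτ.le, one_div_mul_cancel hr.ne', Real.rpow_one,
          ← mul_assoc, ← Real.rpow_add hτ, mul_comm]
        congr 3
        field_simp; ring

theorem auxInterp {E : Type*} [MeasurableSpace E] (ν : Measure E) (f : E → ℝ≥0∞)
    (hf : Measurable f) (q q' : ℝ) (h1 : 1 ≤ q') (h2 : q' ≤ q) (hq : 1 < q) (B : ℝ≥0∞)
    (hB1 : ∫⁻ x, f x ∂ν ≤ B) (hBq : ∫⁻ x, f x ^ q ∂ν ≤ B ^ q) :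
    ∫⁻ x, f x ^ q' ∂ν ≤ B ^ q' := by
  have hq1 : 0 < q - 1 := by linarith
  set a := (q - q') / (q - 1) with ha
  set b := (q' - 1) / (q - 1) with hb
  have ha0 : 0 ≤ a := div_nonneg (by linarith) hq1.le
  have hb0 : 0 ≤ b := div_nonneg (by linarith) hq1.le
  have hab : a + b = 1 := by rw [ha, hb]; field_simp; ring
  have hab' : a + q * b = q' := by rw [ha, hb]; field_simp; ring
  have e : ∀ z : ℝ≥0∞, z ^ q' = z ^ a * (z ^ q) ^ b := by
    intro z
    rw [← ENNReal.rpow_mul, ← ENNReal.rpow_add_of_nonneg _ _ ha0 (by positivity), hab']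
  simp_rw [e]
  refine (ENNReal.lintegral_mul_norm_pow_le hf.aemeasurable (hf.pow_const _).aemeasurable
    ha0 hb0 hab).trans ?_
  gcongr

theorem auxPt (κ γ ε t s : ℝ) (hκ : 1 < κ) (ht : 2 ≤ t) (hs0 : 0 < s) (hst : s < t) :
    (1 + s) ^ (-γ) * auxK ε (-κ) (t - s) ≤ (2 ^ |γ| + 2 ^ |min γ κ|) * t ^ (-(min γ κ)) *
      (auxK ε (-κ) (t - s) + auxK ε (-κ) (1 + s)) := by
  set m := min γ κ with hm
  have hmγ : m ≤ γ := min_le_left _ _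
  have hmκ : m ≤ κ := min_le_right _ _
  have ht0 : 0 < t := by linarith
  have h1s : 0 < 1 + s := by linarith
  have hka := auxK_pos ε (-κ) (t - s) (by linarith)
  have hkb := auxK_pos ε (-κ) (1 + s) h1s
  have hkb' : auxK ε (-κ) (1 + s) = (1 + s) ^ (-κ) := by
    unfold auxK; rw [if_neg (by linarith)]
  have two : ∀ e x y : ℝ, 0 < x → 0 < y → x ≤ 2 * y → y ≤ 2 * x → x ^ e ≤ 2 ^ |e| * y ^ e := by
    intro e x y hx hy hxy hyx
    rcases le_total 0 e with he | he
    · rw [abs_of_nonneg he, ← Real.mul_rpow (by norm_num) hy.le]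
      exact Real.rpow_le_rpow hx.le hxy he
    · rw [abs_of_nonpos he, Real.rpow_neg (by norm_num), ← Real.inv_rpow (by norm_num),
        ← Real.mul_rpow (by norm_num) hy.le]
      exact Real.rpow_le_rpow_of_nonpos (by positivity) (by linarith) he
  have hP : (0:ℝ) < 2 ^ |γ| := by positivity
  have hQ : (0:ℝ) < 2 ^ |m| := by positivity
  have hT : 0 < t ^ (-m) := by positivity
  by_cases hc : t - s ≤ 1
  · have h1 : (1 + s) ^ (-γ) ≤ 2 ^ |γ| * t ^ (-γ) := by
      have := two (-γ) (1 + s) t h1s ht0 (by linarith) (by linarith)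
      rwa [abs_neg] at this
    have h2 : t ^ (-γ) ≤ t ^ (-m) :=
      Real.rpow_le_rpow_of_exponent_le (by linarith) (by linarith)
    calc _ ≤ 2 ^ |γ| * t ^ (-m) * auxK ε (-κ) (t - s) := by
          gcongr
          exact h1.trans (by gcongr)
      _ ≤ _ := by
          gcongr
          · linarith
          · linarith
  push Not at hc
  have hka' : auxK ε (-κ) (t - s) = (t - s) ^ (-κ) := by
    unfold auxK; rw [if_neg (by linarith)]
  have hts : 0 < t - s := by linarith
  rw [hka'] at hka ⊢
  rw [hkb'] at hkb ⊢
  have suff : (1 + s) ^ (-γ) * (t - s) ^ (-κ) ≤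
      2 ^ |m| * t ^ (-m) * ((t - s) ^ (-κ) + (1 + s) ^ (-κ)) := by
    have hγm : (1 + s) ^ (-γ) ≤ (1 + s) ^ (-m) :=
      Real.rpow_le_rpow_of_exponent_le (by linarith) (by linarith)
    have caseA : (1 + s) ^ (-m) ≤ 2 ^ |m| * t ^ (-m) → (1 + s) ^ (-γ) * (t - s) ^ (-κ) ≤
      2 ^ |m| * t ^ (-m) * ((t - s) ^ (-κ) + (1 + s) ^ (-κ)) := by
      intro h
      calc _ ≤ (2 ^ |m| * t ^ (-m)) * (t - s) ^ (-κ) := by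
            gcongr
            exact hγm.trans h
        _ ≤ _ := by gcongr; linarith
    rcases le_total 0 m with hm0 | hm0
    · rcases le_total (t - s) (1 + s) with hle | hle
      · apply caseA
        have := two (-m) (1 + s) t h1s ht0 (by linarith) (by linarith)
        rwa [abs_neg] at this
      · have h3 : (t - s) ^ (-m) ≤ 2 ^ |m| * t ^ (-m) := by
          have := two (-m) (t - s) t hts ht0 (by linarith) (by linarith)
          rwa [abs_neg] at this
        have h4 : (t - s) ^ (m - κ) ≤ (1 + s) ^ (m - κ) :=
          Real.rpow_le_rpow_of_nonpos h1s hle (by linarith)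
        calc _ ≤ (1 + s) ^ (-m) * ((t - s) ^ (-m) * (t - s) ^ (m - κ)) := by
              rw [← Real.rpow_add hts, show -m + (m - κ) = -κ by ring]
              gcongr
          _ ≤ (1 + s) ^ (-m) * ((2 ^ |m| * t ^ (-m)) * (1 + s) ^ (m - κ)) := by gcongr
          _ = (2 ^ |m| * t ^ (-m)) * (1 + s) ^ (-κ) := by
              rw [show -κ = -m + (m - κ) by ring, Real.rpow_add h1s]; ring
          _ ≤ _ := by gcongr; linarith
    · apply caseA
      rw [abs_of_nonpos hm0, ← Real.mul_rpow (by norm_num) ht0.le]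
      exact Real.rpow_le_rpow h1s.le (by linarith) (by linarith)
  refine suff.trans ?_
  gcongr
  linarith

theorem auxInt (κ γ ε : ℝ) (hκ : 1 < κ) (hε : -1 < ε) : ∃ D : ℝ, 0 < D ∧ ∀ t : ℝ, 2 ≤ t →
    ∫⁻ s in Ioo 0 t, ENNReal.ofReal ((1 + s) ^ (-γ) * auxK ε (-κ) (t - s)) ≤
      ENNReal.ofReal (D * t ^ (-(min γ κ))) := by
  set L := ∫⁻ s in Ioi (0:ℝ), ENNReal.ofReal (auxK ε (-κ) s) with hL
  have hLfin : L ≠ ∞ := (auxK_integrable ε (-κ) hε (by linarith)).lintegral_lt_top.ne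
  set c : ℝ := 2 ^ |γ| + 2 ^ |min γ κ| with hc
  have hc0 : 0 < c := by positivity
  refine ⟨c * (2 * L.toReal + 1), by positivity, fun t ht => ?_⟩
  have ht0 : 0 < t := by linarith
  have hkm := auxK_meas ε (-κ)
  have hLi : L = ∫⁻ s, (Ioi (0:ℝ)).indicator (fun s => ENNReal.ofReal (auxK ε (-κ) s)) s := by
    rw [hL, lintegral_indicator measurableSet_Ioi]
  have b1 : ∫⁻ s in Ioo 0 t, ENNReal.ofReal (auxK ε (-κ) (t - s)) ≤ L := by
    rw [hLi, ← lintegral_sub_left_eq_self (μ := (volume : Measure ℝ))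
      ((Ioi (0:ℝ)).indicator (fun s => ENNReal.ofReal (auxK ε (-κ) s))) t, ← lintegral_indicator measurableSet_Ioo]
    refine lintegral_mono fun s => ?_
    by_cases hs : s ∈ Ioo 0 t
    · have : t - s ∈ Ioi (0:ℝ) := by simpa using hs.2
      rw [indicator_of_mem hs, indicator_of_mem this]
    · rw [indicator_of_notMem hs]; exact zero_le
  have b2 : ∫⁻ s in Ioo 0 t, ENNReal.ofReal (auxK ε (-κ) (1 + s)) ≤ L := by
    rw [hLi, ← lintegral_add_left_eq_self (μ := (volume : Measure ℝ))
      ((Ioi (0:ℝ)).indicator (fun s => ENNReal.ofReal (auxK ε (-κ) s))) 1, ← lintegral_indicator measurableSet_Ioo]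
    refine lintegral_mono fun s => ?_
    by_cases hs : s ∈ Ioo 0 t
    · have : 1 + s ∈ Ioi (0:ℝ) := by have := hs.1; simp; linarith
      rw [indicator_of_mem hs, indicator_of_mem this]
    · rw [indicator_of_notMem hs]; exact zero_le
  calc _ ≤ ∫⁻ s in Ioo 0 t, ENNReal.ofReal (c * t ^ (-(min γ κ))) *
        (ENNReal.ofReal (auxK ε (-κ) (t - s)) + ENNReal.ofReal (auxK ε (-κ) (1 + s))) := by
        refine setLIntegral_mono' measurableSet_Ioo fun s hs => ?_
        have k1 := auxK_pos ε (-κ) (t - s) (by linarith [hs.2])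
        have k2 := auxK_pos ε (-κ) (1 + s) (by linarith [hs.1])
        rw [← ENNReal.ofReal_add k1.le k2.le, ← ENNReal.ofReal_mul (by positivity)]
        exact ENNReal.ofReal_le_ofReal (auxPt κ γ ε t s hκ ht hs.1 hs.2)
    _ ≤ ENNReal.ofReal (c * t ^ (-(min γ κ))) * (L + L) := by
        rw [lintegral_const_mul _ (by fun_prop), lintegral_add_left (by fun_prop)]
        gcongr
    _ ≤ ENNReal.ofReal (c * t ^ (-(min γ κ))) * ENNReal.ofReal (2 * L.toReal + 1) := by
        gcongr
        rw [ENNReal.le_ofReal_iff_toReal_le (by simp [hLfin]) (by positivity),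
          ENNReal.toReal_add hLfin hLfin]
        linarith
    _ = _ := by
        rw [← ENNReal.ofReal_mul (by positivity)]
        congr 1; ring

theorem global_decay_between_pc_pstar
    (N : ℕ) (α β : ℝ)
    (hα : 0 < α ∧ α < 1) (hβ : 0 < β ∧ β ≤ 1) (hN : 4 * β < (N : ℝ))
    (G : EuclideanSpace ℝ (Fin N) → ℝ)
    (hGmeas : Measurable G) (hGnonneg : ∀ ξ, 0 ≤ G ξ)
    (c₁ c₂ : ℝ) (hc₁ : 0 < c₁) (hc₂ : 0 < c₂)
    (hGin : ∀ ξ : EuclideanSpace ℝ (Fin N), 0 < ‖ξ‖ → ‖ξ‖ ≤ 1 →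
      c₁ * ‖ξ‖ ^ (4 * β - (N : ℝ)) ≤ G ξ ∧ G ξ ≤ c₂ * ‖ξ‖ ^ (4 * β - (N : ℝ)))
    (hGout : ∀ ξ : EuclideanSpace ℝ (Fin N), 1 ≤ ‖ξ‖ →
      c₁ * ‖ξ‖ ^ (-((N : ℝ) + 2 * β)) ≤ G ξ ∧ G ξ ≤ c₂ * ‖ξ‖ ^ (-((N : ℝ) + 2 * β)))
    (Y : EuclideanSpace ℝ (Fin N) → ℝ → ℝ)
    (hY : ∀ x t, Y x t = t ^ (α - 1 - α * (N : ℝ) / (2 * β)) * G ((t ^ (-(α / (2 * β)))) • x))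
    (f : EuclideanSpace ℝ (Fin N) → ℝ → ℝ)
    (hfmeas : Measurable (Function.uncurry f))
    (γ : ℝ) (C₀ : ℝ) (hC₀ : 0 < C₀)
    (hf1 : ∀ t : ℝ, 0 ≤ t →
      eLpNorm (fun y => f y t) 1 volume ≤ ENNReal.ofReal (C₀ * (1 + t) ^ (-γ)))
    (R₀ C₁ : ℝ) (hR₀ : 0 < R₀) (hC₁ : 0 < C₁)
    (hfdec : ∀ (x : EuclideanSpace ℝ (Fin N)) (t : ℝ), R₀ ≤ ‖x‖ → 0 ≤ t →
      |f x t| ≤ C₁ * ‖x‖ ^ (-(N : ℝ)) * (1 + t) ^ (-γ))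
    (p : ℝ) (hpc : (N : ℝ) / ((N : ℝ) - 2 * β) < p) (hpstar : p < (N : ℝ) / ((N : ℝ) - 4 * β))
    (q : ℝ) (hq : q > (N : ℝ) / (2 * β + (N : ℝ) / p))
    (hfq : ∀ t : ℝ, 0 ≤ t →
      eLpNorm (fun y => f y t) (ENNReal.ofReal q) volume ≤ ENNReal.ofReal (C₀ * (1 + t) ^ (-γ)))
    (u : EuclideanSpace ℝ (Fin N) → ℝ → ℝ)
    (hu : ∀ x t, u x t = ∫ s in Set.Ioc (0:ℝ) t, ∫ y, Y (x - y) (t - s) * f y s) :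
    ∃ C : ℝ, 0 < C ∧ ∀ t : ℝ, 2 ≤ t →
      (γ ≤ 1 - α + (α * (N : ℝ) / (2 * β)) * (1 - 1 / p) →
        eLpNorm (fun x => u x t) (ENNReal.ofReal p) volume ≤ ENNReal.ofReal (C * t ^ (-γ))) ∧
      (1 - α + (α * (N : ℝ) / (2 * β)) * (1 - 1 / p) ≤ γ →
        eLpNorm (fun x => u x t) (ENNReal.ofReal p) volume ≤
          ENNReal.ofReal (C * t ^ (-1 + α - (α * (N : ℝ) / (2 * β)) * (1 - 1 / p)))) := by
  obtain ⟨hα0, hα1⟩ := hα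
  obtain ⟨hβ0, hβ1⟩ := hβ
  have hN0 : 0 < (N : ℝ) := by linarith
  set σ := α / (2 * β) with hσ
  have hσ0 : 0 < σ := by positivity
  have hσβ : σ * (2 * β) = α := by rw [hσ]; field_simp
  have hσN : α * (N : ℝ) / (2 * β) = σ * N := by rw [hσ]; ring
  simp only [hσN] at hY ⊢
  have hp1 : 1 < p := by
    refine lt_of_le_of_lt ?_ hpc
    rw [le_div_iff₀ (by linarith)]; linarith
  have hp0 : 0 < p := by linarith
  have hNp : 2 * β < N * (1 - 1 / p) := by
    rw [div_lt_iff₀ (by linarith)] at hpc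
    have : (N : ℝ) / p < N - 2 * β := by rw [div_lt_iff₀ hp0]; linarith
    have e : N * (1 - 1 / p) = N - N / p := by ring
    rw [e]; linarith
  have hps : p * (N - 4 * β) < N := by
    rwa [lt_div_iff₀ (by linarith)] at hpstar
  set κ := 1 - α + σ * N * (1 - 1 / p) with hκ
  have hκ1 : 1 < κ := by
    have : σ * (2 * β) < σ * (N * (1 - 1 / p)) := by gcongr
    rw [hκ]; nlinarith
  have hden : 0 < 2 * β + (N : ℝ) / p := by positivity
  have hqc1 : 1 < (N : ℝ) / (2 * β + (N : ℝ) / p) := by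
    rw [lt_div_iff₀ hden]
    have e : N * (1 - 1 / p) = N - N / p := by ring
    rw [e] at hNp; linarith
  set q' := min q p with hq'
  have hq'c : (N : ℝ) / (2 * β + (N : ℝ) / p) < q' := by
    refine lt_min hq ?_
    rw [div_lt_iff₀ hden]
    have : p * (2 * β + N / p) = 2 * β * p + N := by field_simp
    rw [this]; nlinarith
  have hq'1 : 1 < q' := hqc1.trans hq'c
  have hq'0 : 0 < q' := by linarith
  have hq'p : q' ≤ p := min_le_right _ _
  have hq'q : q' ≤ q := min_le_left _ _
  have hq1 : 1 < q := hq'1.trans_le hq'q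
  have hiq : 1 / p ≤ 1 / q' := one_div_le_one_div_of_le hq'0 hq'p
  have hiq1 : 1 / q' < 1 := by rw [div_lt_one hq'0]; exact hq'1
  have hip0 : 0 < 1 / p := by positivity
  set r := 1 / (1 + 1 / p - 1 / q') with hr
  have hrinv : 1 / r = 1 + 1 / p - 1 / q' := by rw [hr, one_div_one_div]
  have hrp : r ≤ p := by
    rw [hr, ← one_div_one_div p]
    rw [one_div_one_div p]
    rw [div_le_iff₀ (by linarith)]
    have : p * (1 / p) = 1 := by field_simp
    nlinarith
  have hr1 : 1 ≤ r := by
    rw [hr, le_div_iff₀ (by linarith)]; linarith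
  have hr0 : 0 < r := by linarith
  have hGin' := fun ξ h1 h2 => (hGin ξ h1 h2).2
  have hGout' := fun ξ h1 => (hGout ξ h1).2
  obtain ⟨A₁, hA₁, hY₁⟩ := auxY N α σ G hGmeas p hp0
    (auxG_fin N β hβ0 hN G hGnonneg c₂ hc₂ hGin' hGout' p hp1.le hps)
  obtain ⟨A₂, hA₂, hY₂⟩ := auxY N α σ G hGmeas r hr0
    (auxG_fin N β hβ0 hN G hGnonneg c₂ hc₂ hGin' hGout' r hr1 (by nlinarith))
  set ε := α - 1 - σ * N * (1 - 1 / r) with hε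
  have hε1 : -1 < ε := by
    have h1 : (N : ℝ) / q' < 2 * β + N / p := by
      rw [div_lt_iff₀ hden] at hq'c
      rw [div_lt_iff₀ hq'0]; linarith
    have h2 : σ * (N / q') < σ * (2 * β + N / p) := by gcongr
    have h3 : ε = α - 1 - (σ * (N / q') - σ * (N / p)) := by rw [hε, hrinv]; ring
    rw [h3]
    have h4 : σ * (2 * β + N / p) = α + σ * (N / p) := by rw [mul_add, hσβ]
    linarith
  have hκ' : α - 1 - σ * N * (1 - 1 / p) = -κ := by rw [hκ]; ring
  rw [hκ'] at hY₁
  obtain ⟨D, hD, hDb⟩ := auxInt κ γ ε hκ1 hε1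
  -- measurability
  have hfm : ∀ s, Measurable fun y => f y s := fun s => hfmeas.of_uncurry_right
  have hYm : Measurable (Function.uncurry Y) := by
    have : Function.uncurry Y = fun z : EuclideanSpace ℝ (Fin N) × ℝ =>
        z.2 ^ (α - 1 - σ * N) * G (z.2 ^ (-σ) • z.1) := by
      ext z; exact hY z.1 z.2
    rw [this]
    fun_prop
  -- bounds on f
  have hF1 : ∀ s, 0 ≤ s → ∫⁻ y, ‖f y s‖ₑ ≤ ENNReal.ofReal (C₀ * (1 + s) ^ (-γ)) := by
    intro s hs
    have := hf1 s hs
    rwa [eLpNorm_one_eq_lintegral_enorm] at this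
  have hFq : ∀ s, 0 ≤ s → ∫⁻ y, ‖f y s‖ₑ ^ q' ≤ ENNReal.ofReal (C₀ * (1 + s) ^ (-γ)) ^ q' := by
    intro s hs
    refine auxInterp volume _ (hfm s).enorm q q' hq'1.le hq'q hq1 _ (hF1 s hs) ?_
    have := hfq s hs
    have hq0 : 0 < q := by linarith
    rw [eLpNorm_eq_lintegral_rpow_enorm_toReal (by simp [hq0]) ENNReal.ofReal_ne_top,
      ENNReal.toReal_ofReal hq0.le] at this
    have h2 := ENNReal.rpow_le_rpow this hq0.le
    rwa [← ENNReal.rpow_mul, one_div_mul_cancel hq0.ne', ENNReal.rpow_one] at h2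
  -- space-time estimate
  have hst : ∀ t s : ℝ, 0 < s → s < t →
      ∫⁻ x, (∫⁻ y, ‖Y (x - y) (t - s)‖ₑ * ‖f y s‖ₑ) ^ p ≤
        ENNReal.ofReal ((A₁ + A₂) * C₀ * ((1 + s) ^ (-γ) * auxK ε (-κ) (t - s))) ^ p := by
    intro t s hs hts
    have hτ : 0 < t - s := by linarith
    have h1s : 0 < 1 + s := by linarith
    have hYs : Measurable fun x => ‖Y x (t - s)‖ₑ := hYm.of_uncurry_right.enorm
    have gen : ∀ (A e r q : ℝ), 0 < A → A ≤ A₁ + A₂ → 0 < r → 0 < q → r ≤ p → q ≤ p →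
        1 / p + 1 = 1 / r + 1 / q →
        ∫⁻ x, ‖Y x (t - s)‖ₑ ^ r ≤ ENNReal.ofReal (A * (t - s) ^ e) ^ r →
        ∫⁻ y, ‖f y s‖ₑ ^ q ≤ ENNReal.ofReal (C₀ * (1 + s) ^ (-γ)) ^ q →
        (t - s) ^ e = auxK ε (-κ) (t - s) →
        ∫⁻ x, (∫⁻ y, ‖Y (x - y) (t - s)‖ₑ * ‖f y s‖ₑ) ^ p ≤
        ENNReal.ofReal ((A₁ + A₂) * C₀ * ((1 + s) ^ (-γ) * auxK ε (-κ) (t - s))) ^ p := by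
      intro A e r q hA hAA hr hq hrp hqp hpqr hYb hfb hk
      refine (aux_young _ _ hYs (hfm s).enorm p q r hp0 hq hr hqp hrp hpqr).trans ?_
      calc _ ≤ (ENNReal.ofReal (A * (t - s) ^ e) ^ r) ^ (p / r) *
            (ENNReal.ofReal (C₀ * (1 + s) ^ (-γ)) ^ q) ^ (p / q) := by gcongr
        _ = ENNReal.ofReal ((A * (t - s) ^ e) * (C₀ * (1 + s) ^ (-γ))) ^ p := by
            rw [← ENNReal.rpow_mul, ← ENNReal.rpow_mul, mul_div_cancel₀ _ hr.ne',
              mul_div_cancel₀ _ hq.ne', ← ENNReal.mul_rpow_of_nonneg _ _ hp0.le,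
              ← ENNReal.ofReal_mul (by positivity)]
        _ ≤ _ := by
            rw [← hk]
            refine ENNReal.rpow_le_rpow (ENNReal.ofReal_le_ofReal ?_) hp0.le
            calc _ = A * C₀ * ((1 + s) ^ (-γ) * (t - s) ^ e) := by ring
              _ ≤ _ := by gcongr
    by_cases hc : t - s ≤ 1
    · refine gen A₂ ε r q' hA₂ (by linarith) hr0 hq'0 hrp hq'p (by rw [hrinv]; ring) ?_
        (hFq s hs.le) (by rw [auxK, if_pos hc])
      simp_rw [hY]
      exact hY₂ _ hτ
    · refine gen A₁ (-κ) p 1 hA₁ (by linarith) hp0 one_pos le_rfl hp1.le (by ring) ?_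
        (by simpa using hF1 s hs.le) (by rw [auxK, if_neg hc])
      simp_rw [hY]
      exact hY₁ _ hτ
  -- the main bound
  have main : ∀ t : ℝ, 2 ≤ t → eLpNorm (fun x => u x t) (ENNReal.ofReal p) volume ≤
      ENNReal.ofReal ((A₁ + A₂) * C₀ * D * t ^ (-(min γ κ))) := by
    intro t ht
    have ht0 : 0 < t := by linarith
    rw [eLpNorm_eq_lintegral_rpow_enorm_toReal (by simp [hp0]) ENNReal.ofReal_ne_top,
      ENNReal.toReal_ofReal hp0.le]
    have hub : ∀ x, ‖u x t‖ₑ ≤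
        ∫⁻ s in Ioo 0 t, ∫⁻ y, ‖Y (x - y) (t - s)‖ₑ * ‖f y s‖ₑ := by
      intro x
      rw [hu, restrict_Ioo_eq_restrict_Ioc]
      refine (enorm_integral_le_lintegral_enorm _).trans (lintegral_mono fun s => ?_)
      refine (enorm_integral_le_lintegral_enorm _).trans (lintegral_mono fun y => ?_)
      simp only [enorm_mul]; exact le_rfl
    have hkm := auxK_meas ε (-κ)
    have hmink := aux_minkowski (volume : Measure (EuclideanSpace ℝ (Fin N)))
      (volume.restrict (Ioo 0 t))
      (fun x s => ∫⁻ y, ‖Y (x - y) (t - s)‖ₑ * ‖f y s‖ₑ)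
      (by
        apply Measurable.lintegral_prod_right'
          (f := fun z : (EuclideanSpace ℝ (Fin N) × ℝ) × EuclideanSpace ℝ (Fin N) =>
            ‖Y (z.1.1 - z.2) (t - z.1.2)‖ₑ * ‖f z.2 z.1.2‖ₑ)
        have m1 : Measurable (fun z : (EuclideanSpace ℝ (Fin N) × ℝ) × EuclideanSpace ℝ (Fin N) =>
            Y (z.1.1 - z.2) (t - z.1.2)) :=
          hYm.comp (by fun_prop : Measurable (fun z : (EuclideanSpace ℝ (Fin N) × ℝ) ×
            EuclideanSpace ℝ (Fin N) => ((z.1.1 - z.2, t - z.1.2) : EuclideanSpace ℝ (Fin N) × ℝ)))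
        have m2 : Measurable (fun z : (EuclideanSpace ℝ (Fin N) × ℝ) × EuclideanSpace ℝ (Fin N) =>
            f z.2 z.1.2) :=
          hfmeas.comp (by fun_prop : Measurable (fun z : (EuclideanSpace ℝ (Fin N) × ℝ) ×
            EuclideanSpace ℝ (Fin N) => ((z.2, z.1.2) : EuclideanSpace ℝ (Fin N) × ℝ)))
        exact m1.enorm.mul m2.enorm)
      (fun s => ENNReal.ofReal ((A₁ + A₂) * C₀ * ((1 + s) ^ (-γ) * auxK ε (-κ) (t - s))))
      (by fun_prop) p hp1.le
      (by
        filter_upwards [ae_restrict_mem measurableSet_Ioo] with s hs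
        have k1 := auxK_pos ε (-κ) (t - s) (by linarith [hs.2])
        have h1s : 0 < 1 + s := by linarith [hs.1]
        rw [ne_eq, ENNReal.ofReal_eq_zero, not_le]
        positivity)
      (by simp)
      (by
        filter_upwards [ae_restrict_mem measurableSet_Ioo] with s hs
        exact hst t s hs.1 hs.2)
    have hI : ∫⁻ s in Ioo 0 t,
        ENNReal.ofReal ((A₁ + A₂) * C₀ * ((1 + s) ^ (-γ) * auxK ε (-κ) (t - s))) ≤
        ENNReal.ofReal ((A₁ + A₂) * C₀ * D * t ^ (-(min γ κ))) := by
      have hAC : 0 ≤ (A₁ + A₂) * C₀ := by positivity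
      simp_rw [ENNReal.ofReal_mul hAC]
      rw [lintegral_const_mul _ (by fun_prop), mul_assoc ((A₁ + A₂) * C₀), ENNReal.ofReal_mul hAC]
      gcongr
      exact hDb t ht
    calc (∫⁻ x, ‖u x t‖ₑ ^ p) ^ (1 / p)
        ≤ (∫⁻ x, (∫⁻ s in Ioo 0 t, ∫⁻ y, ‖Y (x - y) (t - s)‖ₑ * ‖f y s‖ₑ) ^ p) ^ (1 / p) := by
          gcongr with x
          exact hub x
      _ ≤ (ENNReal.ofReal ((A₁ + A₂) * C₀ * D * t ^ (-(min γ κ))) ^ p) ^ (1 / p) := by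
          refine ENNReal.rpow_le_rpow (hmink.trans ?_) hip0.le
          exact ENNReal.rpow_le_rpow hI hp0.le
      _ = _ := by
          rw [← ENNReal.rpow_mul, mul_one_div_cancel hp0.ne', ENNReal.rpow_one]
  refine ⟨(A₁ + A₂) * C₀ * D, by positivity, fun t ht => ⟨fun h => ?_, fun h => ?_⟩⟩
  · have := main t ht
    rwa [min_eq_left h] at this
  · have := main t ht
    rw [min_eq_right h] at this
    convert this using 4
    rw [hκ]; ring
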